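/- arXiv:1704.05535 — 3 statements merged into one kernel-verified Lean document; each statement's English description precedes it below -/
import Mathlib

section
/- Let Ω ⊆ [0,1]² be a measurable set of Lebesgue measure 1/2, and let f1(x,y) = |Ω ∩ ([0,x]×[0,y])|. Then the expected squared L2-discrepancy of the two-point jittered sampling construction associated to Ω satisfies D(Ω) = 1/72 + 2·∫₀¹∫₀¹ ( f1(x,y)·x·y − f1(x,y)² ) dx dy. -/
open MeasureTheory Set

noncomputable section

/-- The closed unit square `[0,1]²` in `ℝ × ℝ`. -/
def unitSq : Set (ℝ × ℝ) := Icc (0:ℝ) 1 ×ˢ Icc (0:ℝ) 1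

/-- The anchored axis-parallel box `[0,x] × [0,y]`. -/
def box (x y : ℝ) : Set (ℝ × ℝ) := Icc (0:ℝ) x ×ˢ Icc (0:ℝ) y

/-- The uniform probability measure on a set `S ⊆ ℝ²`. -/
def unif (S : Set (ℝ × ℝ)) : Measure (ℝ × ℝ) := (volume S)⁻¹ • volume.restrict S

/-- The number of the two points `p1`, `p2` lying in the box `[0,x] × [0,y]`. -/
def countIn (p1 p2 : ℝ × ℝ) (x y : ℝ) : ℝ :=
  (box x y).indicator (fun _ => (1:ℝ)) p1 + (box x y).indicator (fun _ => (1:ℝ)) p2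

/-- The squared L2 discrepancy of the two-point multiset `{p1, p2}`. -/
def L2sq (p1 p2 : ℝ × ℝ) : ℝ :=
  ∫ x in (0:ℝ)..1, ∫ y in (0:ℝ)..1, |countIn p1 p2 x y / 2 - x * y| ^ 2

/-- The joint law of the jittered pair `(p1, p2)`: `p1` uniform on `Ω`,
`p2` uniform on `[0,1]² \ Ω`, independent. -/
def jitter (Ω : Set (ℝ × ℝ)) : Measure ((ℝ × ℝ) × (ℝ × ℝ)) :=
  (unif Ω).prod (unif (unitSq \ Ω))

/-- The expected squared L2 discrepancy of the two-point jittered sampling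
construction associated to `Ω`. -/
def Djit (Ω : Set (ℝ × ℝ)) : ℝ := ∫ q, L2sq q.1 q.2 ∂(jitter Ω)

/-- `f1 Ω x y` is the Lebesgue measure of `Ω ∩ ([0,x] × [0,y])`. -/
def f1 (Ω : Set (ℝ × ℝ)) (x y : ℝ) : ℝ := (volume (Ω ∩ box x y)).toReal

/-- The hypograph of `g` within the unit square. -/
def hypo (g : ℝ → ℝ) : Set (ℝ × ℝ) := {q ∈ unitSq | q.2 ≤ g q.1}

/-- `g` is an admissible partitioning function for area `p`: it is monotonically
decreasing on `[0,1]`, maps `[0,1]` into `[0,1]`, its hypograph has Lebesgue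
measure `p`, and its hypograph is symmetric about the diagonal `y = x` up to a
Lebesgue-null set. -/
def Admissible (p : ℝ) (g : ℝ → ℝ) : Prop :=
  AntitoneOn g (Icc (0:ℝ) 1) ∧ (∀ x ∈ Icc (0:ℝ) 1, g x ∈ Icc (0:ℝ) 1) ∧
  volume (hypo g) = ENNReal.ofReal p ∧
  (∀ᵐ q ∂(volume.restrict unitSq), (q ∈ hypo g ↔ q.swap ∈ hypo g))

end

lemma measurableSet_box (x y : ℝ) : MeasurableSet (box x y) :=
  measurableSet_Icc.prod measurableSet_Icc

lemma measurableSet_unitSq : MeasurableSet unitSq :=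
  measurableSet_Icc.prod measurableSet_Icc

lemma volume_unitSq : volume unitSq = 1 := by
  rw [unitSq, Measure.volume_eq_prod, Measure.prod_prod]
  simp

lemma volume_unitSq_diff {Ω : Set (ℝ × ℝ)} (hΩ : MeasurableSet Ω) (hsub : Ω ⊆ unitSq)
    (hvol : volume Ω = 1 / 2) : volume (unitSq \ Ω) = 1 / 2 := by
  rw [measure_sdiff hsub hΩ.nullMeasurableSet (by simp [hvol]), volume_unitSq, hvol]
  simp

lemma volume_box (x y : ℝ) : volume (box x y) = ENNReal.ofReal x * ENNReal.ofReal y := by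
  rw [box, Measure.volume_eq_prod, Measure.prod_prod]
  simp

lemma box_subset_unitSq {x y : ℝ} (hx : x ≤ 1) (hy : y ≤ 1) : box x y ⊆ unitSq :=
  prod_mono (Icc_subset_Icc_right hx) (Icc_subset_Icc_right hy)

lemma measurable_indicator_box {α : Type*} [MeasurableSpace α] {p z : α → ℝ × ℝ}
    (hp : Measurable p) (hz : Measurable z) :
    Measurable fun a => (box (z a).1 (z a).2).indicator (fun _ => (1 : ℝ)) (p a) := by
  have hs : MeasurableSet {a | p a ∈ box (z a).1 (z a).2} := by
    simp only [box, mem_prod, mem_Icc, measurableSet_setOfPred]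
    refine Measurable.and (Measurable.and ?_ ?_) (Measurable.and ?_ ?_) <;>
      exact measurableSet_setOfPred.1 (measurableSet_le (by fun_prop) (by fun_prop))
  exact (measurable_const (a := (1 : ℝ))).indicator hs

lemma unif_real_apply (S : Set (ℝ × ℝ)) {T : Set (ℝ × ℝ)} (hT : MeasurableSet T) :
    (unif S).real T = (volume.real S)⁻¹ * volume.real (S ∩ T) := by
  simp [unif, Measure.real, Measure.restrict_apply hT, inter_comm]

lemma isProbabilityMeasure_unif {S : Set (ℝ × ℝ)} (h0 : volume S ≠ 0) (h : volume S ≠ ⊤) :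
    IsProbabilityMeasure (unif S) :=
  ⟨by simp [unif, ENNReal.inv_mul_cancel h0 h]⟩

/-- An iterated integral over the unit square as an integral against a product measure. -/
lemma intervalIntegral_intervalIntegral_eq_integral_prod {F : ℝ → ℝ → ℝ}
    (hF : Integrable (fun z : ℝ × ℝ => F z.1 z.2)
      ((volume.restrict (Ioc (0 : ℝ) 1)).prod (volume.restrict (Ioc (0 : ℝ) 1)))) :
    ∫ x in (0 : ℝ)..1, ∫ y in (0 : ℝ)..1, F x y =
      ∫ z, F z.1 z.2 ∂((volume.restrict (Ioc (0 : ℝ) 1)).prod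
        (volume.restrict (Ioc (0 : ℝ) 1))) := by
  rw [integral_prod _ hF]
  simp only [intervalIntegral.integral_of_le zero_le_one]

lemma ae_mem_Ioc_prod : ∀ᵐ z ∂((volume.restrict (Ioc (0 : ℝ) 1)).prod
    (volume.restrict (Ioc (0 : ℝ) 1))), z ∈ Ioc (0 : ℝ) 1 ×ˢ Ioc (0 : ℝ) 1 := by
  rw [Measure.prod_restrict]
  exact ae_restrict_mem (measurableSet_Ioc.prod measurableSet_Ioc)

lemma countIn_mem_Icc (p q : ℝ × ℝ) (x y : ℝ) : countIn p q x y ∈ Icc (0 : ℝ) 2 := by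
  unfold countIn indicator
  split_ifs <;> norm_num

lemma abs_discrepancy_sq_le_one (p q : ℝ × ℝ) {x y : ℝ} (hx : x ∈ Ioc (0 : ℝ) 1)
    (hy : y ∈ Ioc (0 : ℝ) 1) : ‖|countIn p q x y / 2 - x * y| ^ 2‖ ≤ 1 := by
  obtain ⟨h0, h2⟩ := countIn_mem_Icc p q x y
  have h3 : 0 ≤ x * y := mul_nonneg hx.1.le hy.1.le
  have h4 : x * y ≤ 1 := mul_le_one₀ hx.2 hy.1.le hy.2
  rw [norm_pow, Real.norm_eq_abs, abs_abs]
  exact pow_le_one₀ (abs_nonneg _) (abs_le.2 ⟨by linarith, by linarith⟩)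

lemma measurable_discrepancy_sq : Measurable fun w : ((ℝ × ℝ) × (ℝ × ℝ)) × (ℝ × ℝ) =>
    |countIn w.1.1 w.1.2 w.2.1 w.2.2 / 2 - w.2.1 * w.2.2| ^ 2 := by
  simp only [sq_abs]
  unfold countIn
  have h1 := measurable_indicator_box (α := ((ℝ × ℝ) × (ℝ × ℝ)) × (ℝ × ℝ))
    (p := fun w => w.1.1) (z := fun w => w.2) (by fun_prop) (by fun_prop)
  have h2 := measurable_indicator_box (α := ((ℝ × ℝ) × (ℝ × ℝ)) × (ℝ × ℝ))
    (p := fun w => w.1.2) (z := fun w => w.2) (by fun_prop) (by fun_prop)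
  fun_prop

/-- The second moment of `(1_B(p) + 1_B(q)) / 2 - t` for independent `p`, `q`. -/
lemma integral_prod_half_indicator_add_sub_sq {α : Type*} [MeasurableSpace α] (μ ν : Measure α)
    [IsProbabilityMeasure μ] [IsProbabilityMeasure ν] {B : Set α} (hB : MeasurableSet B) (t : ℝ) :
    ∫ q, ((B.indicator (fun _ => (1 : ℝ)) q.1 + B.indicator (fun _ => (1 : ℝ)) q.2) / 2 - t) ^ 2
        ∂(μ.prod ν) =
      (1 / 4 - t) * (μ.real B + ν.real B) + μ.real B * ν.real B / 2 + t ^ 2 := by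
  set X : α → ℝ := B.indicator fun _ => (1 : ℝ) with hX
  have hsq (a : α) : X a ^ 2 = X a := by
    by_cases h : a ∈ B <;> simp [hX, h]
  have hiX (κ : Measure α) [IsProbabilityMeasure κ] : Integrable X κ :=
    (integrable_const 1).indicator hB
  have hint (κ : Measure α) [IsProbabilityMeasure κ] : ∫ a, X a ∂κ = κ.real B :=
    integral_indicator_one hB
  have h1 : Integrable (fun q : α × α => X q.1) (μ.prod ν) := (hiX μ).comp_fst ν
  have h2 : Integrable (fun q : α × α => X q.2) (μ.prod ν) := (hiX ν).comp_snd μ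
  have h3 : Integrable (fun q : α × α => X q.1 * X q.2) (μ.prod ν) := (hiX μ).mul_prod (hiX ν)
  have hexp (q : α × α) : ((X q.1 + X q.2) / 2 - t) ^ 2 =
      (1 / 4 - t) * (X q.1 + X q.2) + 1 / 2 * (X q.1 * X q.2) + t ^ 2 := by
    linear_combination (1 / 4) * hsq q.1 + (1 / 4) * hsq q.2
  simp_rw [hexp]
  have h4 : Integrable (fun q : α × α => (1 / 4 - t) * (X q.1 + X q.2)) (μ.prod ν) :=
    (h1.add h2).const_mul _
  have h5 : Integrable (fun q : α × α => 1 / 2 * (X q.1 * X q.2)) (μ.prod ν) := h3.const_mul _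
  have h6 : Integrable (fun q : α × α => (1 / 4 - t) * (X q.1 + X q.2) + 1 / 2 * (X q.1 * X q.2))
      (μ.prod ν) := h4.add h5
  rw [integral_add h6 (integrable_const _), integral_add h4 h5, integral_const_mul,
    integral_const_mul, integral_add h1 h2, integral_prod_mul, integral_fun_fst, integral_fun_snd,
    hint, hint]
  simp
  ring

lemma integral_jitter_discrepancy_sq {Ω : Set (ℝ × ℝ)} (hΩ : MeasurableSet Ω)
    (hsub : Ω ⊆ unitSq) (hvol : volume Ω = 1 / 2) {x y : ℝ} (hx : x ∈ Ioc (0 : ℝ) 1)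
    (hy : y ∈ Ioc (0 : ℝ) 1) :
    ∫ q, |countIn q.1 q.2 x y / 2 - x * y| ^ 2 ∂(jitter Ω) =
      x * y / 2 - (x * y) ^ 2 + 2 * (f1 Ω x y * (x * y) - f1 Ω x y ^ 2) := by
  have hvol' := volume_unitSq_diff hΩ hsub hvol
  have := isProbabilityMeasure_unif (S := Ω) (by simp [hvol]) (by simp [hvol])
  have := isProbabilityMeasure_unif (S := unitSq \ Ω) (by simp [hvol']) (by simp [hvol'])
  have hA : (unif Ω).real (box x y) = 2 * f1 Ω x y := by
    rw [unif_real_apply _ (measurableSet_box x y)]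
    simp [f1, Measure.real, hvol]
  have hbox : volume.real (box x y) = x * y := by
    simp [Measure.real, volume_box, hx.1.le, hy.1.le]
  have hsplit : volume.real ((unitSq \ Ω) ∩ box x y) = x * y - f1 Ω x y := by
    have hset : (unitSq \ Ω) ∩ box x y = box x y \ Ω := by
      ext p
      have := @box_subset_unitSq x y hx.2 hy.2 p
      simp only [mem_inter_iff, mem_sdiff]
      tauto
    have hadd := measureReal_inter_add_sdiff (μ := volume) (s := box x y) hΩ
      (by simp [volume_box, ENNReal.mul_eq_top])
    have hf : f1 Ω x y = volume.real (box x y ∩ Ω) := by rw [inter_comm]; rfl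
    rw [hset, hf]
    linarith
  have hB : (unif (unitSq \ Ω)).real (box x y) = 2 * (x * y - f1 Ω x y) := by
    rw [unif_real_apply _ (measurableSet_box x y), hsplit]
    simp [Measure.real, hvol']
  simp only [sq_abs, countIn, jitter]
  rw [integral_prod_half_indicator_add_sub_sq _ _ (measurableSet_box x y), hA, hB]
  ring

/-- For a measurable `Ω ⊆ [0,1]²` of Lebesgue measure `1/2`, the
expected squared L2-discrepancy of the two-point jittered sampling construction is
`1/72 + 2 ∫₀¹∫₀¹ (f1(x,y)·x·y − f1(x,y)²) dx dy`. -/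
theorem expected_discrepancy_formula
    (Ω : Set (ℝ × ℝ)) (hΩ : MeasurableSet Ω) (hsub : Ω ⊆ unitSq)
    (hvol : volume Ω = 1/2) :
    Djit Ω = 1/72 + 2 * ∫ x in (0:ℝ)..1, ∫ y in (0:ℝ)..1,
      (f1 Ω x y * (x * y) - (f1 Ω x y)^2) := by
  set m : Measure (ℝ × ℝ) :=
    (volume.restrict (Ioc (0 : ℝ) 1)).prod (volume.restrict (Ioc (0 : ℝ) 1))
  have hvol' := volume_unitSq_diff hΩ hsub hvol
  have := isProbabilityMeasure_unif (S := Ω) (by simp [hvol]) (by simp [hvol])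
  have := isProbabilityMeasure_unif (S := unitSq \ Ω) (by simp [hvol']) (by simp [hvol'])
  have : IsProbabilityMeasure (jitter Ω) := by unfold jitter; infer_instance
  have hL (q : (ℝ × ℝ) × (ℝ × ℝ)) :
      L2sq q.1 q.2 = ∫ z, |countIn q.1 q.2 z.1 z.2 / 2 - z.1 * z.2| ^ 2 ∂m := by
    refine intervalIntegral_intervalIntegral_eq_integral_prod (.of_bound
      (measurable_discrepancy_sq.comp measurable_prodMk_left).aestronglyMeasurable 1 ?_)
    filter_upwards [ae_mem_Ioc_prod] with z hz
    exact abs_discrepancy_sq_le_one _ _ hz.1 hz.2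
  have hint : Integrable (fun w : ((ℝ × ℝ) × (ℝ × ℝ)) × (ℝ × ℝ) =>
      |countIn w.1.1 w.1.2 w.2.1 w.2.2 / 2 - w.2.1 * w.2.2| ^ 2) ((jitter Ω).prod m) := by
    refine .of_bound measurable_discrepancy_sq.aestronglyMeasurable 1 ?_
    filter_upwards [Measure.quasiMeasurePreserving_snd.ae ae_mem_Ioc_prod] with w hw
    exact abs_discrepancy_sq_le_one _ _ hw.1 hw.2
  set G : ℝ × ℝ → ℝ := fun z =>
    ∫ q, |countIn q.1 q.2 z.1 z.2 / 2 - z.1 * z.2| ^ 2 ∂(jitter Ω) with hG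
  have hGint : Integrable G m := hint.integral_prod_right
  have hD : Djit Ω = ∫ z, G z ∂m := by
    simp only [Djit, hL]
    exact integral_integral_swap hint
  have hPint : Integrable (fun z : ℝ × ℝ => z.1 * z.2 / 2 - (z.1 * z.2) ^ 2) m := by
    refine .of_bound (by fun_prop) 1 ?_
    filter_upwards [ae_mem_Ioc_prod] with z hz
    have h3 : 0 ≤ z.1 * z.2 := mul_nonneg hz.1.1.le hz.2.1.le
    have h4 : z.1 * z.2 ≤ 1 := mul_le_one₀ hz.1.2 hz.2.1.le hz.2.2
    rw [Real.norm_eq_abs, abs_le]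
    constructor <;> nlinarith
  have hP : ∫ z, (z.1 * z.2 / 2 - (z.1 * z.2) ^ 2) ∂m = 1 / 72 := by
    rw [← intervalIntegral_intervalIntegral_eq_integral_prod
      (F := fun x y => x * y / 2 - (x * y) ^ 2) hPint]
    have hinner (x : ℝ) : ∫ y in (0 : ℝ)..1, (x * y / 2 - (x * y) ^ 2) = x / 4 - x ^ 2 / 3 := by
      simp only [mul_pow]
      rw [intervalIntegral.integral_sub (Continuous.intervalIntegrable (by fun_prop) _ _)
        (Continuous.intervalIntegrable (by fun_prop) _ _),
        intervalIntegral.integral_div, intervalIntegral.integral_const_mul,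
        intervalIntegral.integral_const_mul, integral_id, integral_pow]
      ring
    simp only [hinner]
    rw [intervalIntegral.integral_sub (Continuous.intervalIntegrable (by fun_prop) _ _)
      (Continuous.intervalIntegrable (by fun_prop) _ _)]
    simp
    norm_num
  have hH : (fun z : ℝ × ℝ => f1 Ω z.1 z.2 * (z.1 * z.2) - f1 Ω z.1 z.2 ^ 2) =ᵐ[m]
      fun z => 1 / 2 * (G z - (z.1 * z.2 / 2 - (z.1 * z.2) ^ 2)) := by
    filter_upwards [ae_mem_Ioc_prod] with z hz
    simp only [hG, integral_jitter_discrepancy_sq hΩ hsub hvol hz.1 hz.2]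
    ring
  rw [intervalIntegral_intervalIntegral_eq_integral_prod
      (((hGint.sub hPint).const_mul (1 / 2)).congr hH.symm), integral_congr_ae hH,
    integral_const_mul, integral_sub hGint hPint, hP, hD]
  ring
end

section
/- Let g : [0,1] → [0,1] be a monotonically decreasing function whose hypograph Ω_g = {(u,v) ∈ [0,1]² : v ≤ g(u)} is symmetric about the line y = x (i.e. for almost every (u,v) ∈ [0,1]², v ≤ g(u) if and only if u ≤ g(v)), and let f1(x,y) = |Ω_g ∩ ([0,x]×[0,y])|. Then for every x ∈ [0,1], ∫_{g(x)}^{1} f1(x,y) dy = x·g(x)·(1 − g(x)) + ∫_{g(x)}^{1} (1 − y)·g(y) dy. -/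
open MeasureTheory Set

/-- Fubini's theorem on the triangle `a ≤ v ≤ y ≤ b`. -/
theorem integral_primitive_eq_integral_sub_mul {a b : ℝ} (hab : a ≤ b) {G : ℝ → ℝ}
    (hG : IntervalIntegrable G volume a b) :
    ∫ y in a..b, ∫ v in a..y, G v = ∫ y in a..b, (b - y) * G y := by
  have hG' : IntegrableOn G (Ioc a b) := (intervalIntegrable_iff_integrableOn_Ioc_of_le hab).1 hG
  have h_int : Integrable (fun p : ℝ × ℝ => {q : ℝ × ℝ | q.2 ≤ q.1}.indicator (fun q => G q.2) p)
      ((volume.restrict (Ioc a b)).prod (volume.restrict (Ioc a b))) :=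
    Integrable.indicator (hG'.comp_snd _) (measurableSet_le measurable_snd measurable_fst)
  rw [intervalIntegral.integral_of_le hab, intervalIntegral.integral_of_le hab]
  calc
    _ = ∫ y in Ioc a b, ∫ v in Ioc a b,
        {q : ℝ × ℝ | q.2 ≤ q.1}.indicator (fun q => G q.2) (y, v) := by
      refine setIntegral_congr_fun measurableSet_Ioc fun y hy => ?_
      have h : (fun v => {q : ℝ × ℝ | q.2 ≤ q.1}.indicator (fun q => G q.2) (y, v))
          = (Iic y).indicator G := by
        ext v; simp [indicator]
      simp only [h]
      rw [setIntegral_indicator measurableSet_Iic, intervalIntegral.integral_of_le hy.1.le,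
        Ioc_inter_Iic, min_eq_right hy.2]
    _ = ∫ v in Ioc a b, ∫ y in Ioc a b,
        {q : ℝ × ℝ | q.2 ≤ q.1}.indicator (fun q => G q.2) (y, v) :=
      integral_integral_swap h_int
    _ = _ := by
      refine setIntegral_congr_fun measurableSet_Ioc fun v hv => ?_
      have h : (fun y => {q : ℝ × ℝ | q.2 ≤ q.1}.indicator (fun q => G q.2) (y, v))
          = (Ici v).indicator (fun _ => G v) := by
        ext y; simp [indicator]
      have h' : Ioc a b ∩ Ici v = Icc v b := by
        ext y
        simp only [mem_inter_iff, mem_Ioc, mem_Ici, mem_Icc]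
        exact ⟨fun hy => ⟨hy.2, hy.1.2⟩, fun hy => ⟨⟨hv.1.trans_le hy.1, hy.2⟩, hy.1⟩⟩
      simp only [h]
      rw [setIntegral_indicator measurableSet_Ici, h', setIntegral_const]
      simp [hv.2]

/-- The area of a symmetric hypograph inside a box whose upper right corner lies above the graph. -/
theorem f1_hypo_eq (g : ℝ → ℝ) (hmono : AntitoneOn g (Icc (0:ℝ) 1))
    (hrange : ∀ x ∈ Icc (0:ℝ) 1, g x ∈ Icc (0:ℝ) 1)
    (hsym : ∀ᵐ q ∂(volume.restrict unitSq), (q.2 ≤ g q.1 ↔ q.1 ≤ g q.2))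
    {x y : ℝ} (hx : x ∈ Icc (0:ℝ) 1) (hy : y ∈ Icc (g x) 1) :
    f1 (hypo g) x y = x * g x + ∫ v in (g x)..y, g v := by
  have hgx := hrange x hx
  have hmeas : MeasurableSet (hypo g ∩ box x y) := by
    have hmono' : Antitone fun u : ℝ => g (projIcc 0 1 zero_le_one u) := fun u v huv =>
      hmono (Subtype.coe_prop _) (Subtype.coe_prop _) (monotone_projIcc _ huv)
    have heq : hypo g = unitSq ∩ {q | q.2 ≤ g (projIcc 0 1 zero_le_one q.1)} := by
      ext q
      refine and_congr_right fun hq => ?_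
      rw [mem_ofPred_eq, projIcc_of_mem _ hq.1]
    rw [heq]
    exact ((measurableSet_Icc.prod measurableSet_Icc).inter
      (measurableSet_le measurable_snd (hmono'.measurable.comp measurable_fst))).inter
      (measurableSet_Icc.prod measurableSet_Icc)
  have hslice : ∀ᵐ v : ℝ, volume ((fun u => (u, v)) ⁻¹' (hypo g ∩ box x y)) =
      (Icc 0 (g x)).indicator (fun _ => ENNReal.ofReal x) v +
        (Ioc (g x) y).indicator (fun v => ENNReal.ofReal (g v)) v := by
    have hsq : MeasurableSet unitSq := measurableSet_Icc.prod measurableSet_Icc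
    rw [ae_restrict_iff' hsq, Measure.volume_eq_prod] at hsym
    filter_upwards [Measure.ae_ae_of_ae_prod hsym] with v hv
    by_cases h0 : v ∈ Icc 0 (g x)
    · have h1 : v ∉ Ioc (g x) y := fun h => h.1.not_ge h0.2
      have hset : (fun u => (u, v)) ⁻¹' (hypo g ∩ box x y) = Icc 0 x := by
        ext u
        refine ⟨fun hu => hu.2.1, fun hu => ?_⟩
        have hu1 : u ∈ Icc (0:ℝ) 1 := ⟨hu.1, hu.2.trans hx.2⟩
        exact ⟨⟨⟨hu1, h0.1, h0.2.trans hgx.2⟩, h0.2.trans (hmono hu1 hx hu.2)⟩, hu,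
          h0.1, h0.2.trans hy.1⟩
      simp [hset, h0, h1]
    by_cases h1 : v ∈ Ioc (g x) y
    · have hv1 : v ∈ Icc (0:ℝ) 1 := ⟨hgx.1.trans h1.1.le, h1.2.trans hy.2⟩
      have hset : ((fun u => (u, v)) ⁻¹' (hypo g ∩ box x y) : Set ℝ) =ᵐ[volume] Icc 0 (g v) := by
        rw [Filter.eventuallyEq_set]
        filter_upwards [hv] with u hu
        constructor
        · intro h
          exact ⟨h.2.1.1, (hu ⟨hv1, h.1.1.1⟩).2 h.1.2⟩
        · intro h
          have hu1 : u ∈ Icc (0:ℝ) 1 := ⟨h.1, h.2.trans (hrange v hv1).2⟩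
          have hvu : v ≤ g u := (hu ⟨hv1, hu1⟩).1 h.2
          refine ⟨⟨⟨hu1, hv1⟩, hvu⟩, ⟨h.1, ?_⟩, hv1.1, h1.2⟩
          by_contra! hxu
          exact (h1.1.trans_le hvu).not_ge (hmono hx hu1 hxu.le)
      rw [measure_congr hset]
      simp [h0, h1]
    · have hset : (fun u => (u, v)) ⁻¹' (hypo g ∩ box x y) = ∅ := by
        ext u
        refine ⟨fun hu => ?_, fun hu => hu.elim⟩
        have hv0 : 0 ≤ v := hu.2.2.1
        have hvy : v ≤ y := hu.2.2.2
        rcases le_or_gt v (g x) with h | h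
        · exact h0 ⟨hv0, h⟩
        · exact h1 ⟨h, hvy⟩
      simp [hset, h0, h1]
  have hsub : Icc (g x) y ⊆ Icc (0:ℝ) 1 := Icc_subset_Icc hgx.1 hy.2
  have h_int : IntegrableOn g (Ioc (g x) y) :=
    ((hmono.mono hsub).integrableOn_isCompact isCompact_Icc).mono_set Ioc_subset_Icc_self
  have hnn : ∀ v ∈ Ioc (g x) y, 0 ≤ g v := fun v hv =>
    (hrange v (hsub (Ioc_subset_Icc_self hv))).1
  rw [f1, Measure.volume_eq_prod, Measure.prod_apply_symm hmeas, lintegral_congr_ae hslice,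
    lintegral_add_left (measurable_const.indicator measurableSet_Icc),
    lintegral_indicator measurableSet_Icc, lintegral_indicator measurableSet_Ioc,
    ← ofReal_integral_eq_lintegral_ofReal h_int
      ((ae_restrict_iff' measurableSet_Ioc).2 (ae_of_all _ hnn)),
    setLIntegral_const, Real.volume_Icc, sub_zero, ← ENNReal.ofReal_mul hx.1,
    ← ENNReal.ofReal_add (mul_nonneg hx.1 hgx.1) (setIntegral_nonneg measurableSet_Ioc hnn),
    ENNReal.toReal_ofReal (add_nonneg (mul_nonneg hx.1 hgx.1)
      (setIntegral_nonneg measurableSet_Ioc hnn)),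
    intervalIntegral.integral_of_le hy.1]

/-- For a monotonically decreasing `g : [0,1] → [0,1]` whose
hypograph is symmetric about the diagonal up to a null set,
`∫_{g x}^{1} f1(x,y) dy = x·g(x)·(1 − g(x)) + ∫_{g x}^{1} (1 − y)·g(y) dy`. -/
theorem f1_integral_ell1
    (g : ℝ → ℝ) (hmono : AntitoneOn g (Icc (0:ℝ) 1))
    (hrange : ∀ x ∈ Icc (0:ℝ) 1, g x ∈ Icc (0:ℝ) 1)
    (hsym : ∀ᵐ q ∂(volume.restrict unitSq), (q.2 ≤ g q.1 ↔ q.1 ≤ g q.2)) :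
    ∀ x ∈ Icc (0:ℝ) 1,
      (∫ y in (g x)..1, f1 (hypo g) x y)
        = x * g x * (1 - g x) + ∫ y in (g x)..1, (1 - y) * g y := by
  intro x hx
  have hgx := hrange x hx
  have h_int : IntervalIntegrable g volume (g x) 1 := by
    refine AntitoneOn.intervalIntegrable (hmono.mono ?_)
    rw [uIcc_of_le hgx.2]
    exact Icc_subset_Icc_left hgx.1
  have hprim : IntervalIntegrable (fun y => ∫ v in (g x)..y, g v) volume (g x) 1 :=
    (intervalIntegral.continuousOn_primitive_interval' h_int left_mem_uIcc).intervalIntegrable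
  rw [intervalIntegral.integral_congr (g := fun y => x * g x + ∫ v in (g x)..y, g v) fun y hy =>
      f1_hypo_eq g hmono hrange hsym hx (by rwa [uIcc_of_le hgx.2] at hy),
    intervalIntegral.integral_add intervalIntegrable_const hprim,
    intervalIntegral.integral_const, integral_primitive_eq_integral_sub_mul hgx.2 h_int, smul_eq_mul]
  ring
end

section
/- Let g : [0,1] → [0,1] be a monotonically decreasing function, let Ω_g = {(u,v) ∈ [0,1]² : v ≤ g(u)} be its hypograph, and let f1(x,y) = |Ω_g ∩ ([0,x]×[0,y])|. Then for every x ∈ [0,1], ∫_{x}^{1} f1(z, g(x)) dz = x·g(x)·(1 − x) + ∫_{x}^{1} (1 − y)·g(y) dy. -/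
open MeasureTheory Set

/-- Cauchy's formula for a repeated integral. -/
lemma integral_integral_eq_integral_sub_mul {g : ℝ → ℝ} {a b : ℝ}
    (hg : IntervalIntegrable g volume a b) :
    (∫ z in a..b, ∫ y in a..z, g y) = ∫ y in a..b, (b - y) * g y := by
  have hac := hg.absolutelyContinuousOnInterval_intervalIntegral (c := a) left_mem_uIcc
  have hsub : AbsolutelyContinuousOnInterval (fun z : ℝ => b - z) a b :=
    ContDiffOn.absolutelyContinuousOnInterval (by fun_prop)
  have hparts := hsub.integral_mul_deriv_eq_deriv_mul hac
  have hderiv : (∫ z in a..b, (b - z) * deriv (fun z => ∫ y in a..z, g y) z)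
      = ∫ y in a..b, (b - y) * g y := by
    apply intervalIntegral.integral_congr_ae
    filter_upwards [hg.ae_hasDerivAt_integral] with z hz hzab
    rw [(hz (uIoc_subset_uIcc hzab) a left_mem_uIcc).deriv]
  rw [← hderiv, hparts]
  simp

/-- The measure of a box cut by the hypograph of an antitone function. -/
lemma f1_hypo_eq_integral_min {g : ℝ → ℝ} (hmono : AntitoneOn g (Icc (0:ℝ) 1))
    (hrange : ∀ x ∈ Icc (0:ℝ) 1, g x ∈ Icc (0:ℝ) 1)
    {z y : ℝ} (hz : z ∈ Icc (0:ℝ) 1) (hy : y ∈ Icc (0:ℝ) 1) :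
    f1 (hypo g) z y = ∫ u in (0:ℝ)..z, min (g u) y := by
  set G : ℝ → ℝ := IccExtend zero_le_one ((Icc (0:ℝ) 1).domRestrict g)
  have hGg : ∀ u ∈ Icc (0:ℝ) 1, G u = g u := fun u hu => IccExtend_of_mem _ _ hu
  have hGmeas : Measurable G := by
    refine Antitone.measurable fun u v huv => ?_
    exact hmono (projIcc 0 1 zero_le_one u).2 (projIcc 0 1 zero_le_one v).2
      (monotone_projIcc zero_le_one huv)
  have hGnonneg : ∀ u, 0 ≤ G u := fun u => (hrange _ (projIcc 0 1 zero_le_one u).2).1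
  have hsub : Icc (0:ℝ) z ⊆ Icc 0 1 := Icc_subset_Icc_right hz.2
  have hset : hypo g ∩ box z y
      = {p : ℝ × ℝ | p.1 ∈ Icc (0:ℝ) z ∧ p.2 ∈ Icc (0:ℝ) (min (G p.1) y)} := by
    ext ⟨u, v⟩
    simp only [hypo, unitSq, box, mem_inter_iff, mem_ofPred_eq, mem_prod]
    constructor
    · rintro ⟨⟨⟨hu, -⟩, hvg⟩, huz, hv⟩
      exact ⟨huz, hv.1, le_min (by rwa [hGg u hu]) hv.2⟩
    · rintro ⟨huz, hv0, hv⟩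
      have hvy := hv.trans (min_le_right _ _)
      exact ⟨⟨⟨hsub huz, hv0, hvy.trans hy.2⟩, by
        simpa only [hGg u (hsub huz)] using hv.trans (min_le_left _ _)⟩, huz, hv0, hvy⟩
  have hmeas : Measurable fun u => min (G u) y := hGmeas.min measurable_const
  have hvol : volume (hypo g ∩ box z y)
      = ∫⁻ u in Icc (0:ℝ) z, ENNReal.ofReal (min (G u) y) := by
    rw [hset, Measure.volume_eq_prod, Measure.prod_apply
      (measurableSet_region_between_cc measurable_const hmeas measurableSet_Icc),
      ← lintegral_indicator measurableSet_Icc]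
    congr 1 with u
    by_cases hu : u ∈ Icc (0:ℝ) z
    · have : Prod.mk u ⁻¹' {p : ℝ × ℝ | p.1 ∈ Icc (0:ℝ) z ∧ p.2 ∈ Icc (0:ℝ) (min (G p.1) y)}
          = Icc (0:ℝ) (min (G u) y) := by
        ext v
        exact and_iff_right hu
      rw [this, indicator_of_mem hu, Real.volume_Icc, sub_zero]
    · have : Prod.mk u ⁻¹' {p : ℝ × ℝ | p.1 ∈ Icc (0:ℝ) z ∧ p.2 ∈ Icc (0:ℝ) (min (G p.1) y)}
          = ∅ := by
        ext v
        exact iff_of_false (fun h => hu h.1) (notMem_empty v)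
      rw [this, indicator_of_notMem hu, measure_empty]
  rw [f1, hvol, intervalIntegral.integral_of_le hz.1, ← integral_Icc_eq_integral_Ioc,
    ← integral_eq_lintegral_of_nonneg_ae
      (Filter.Eventually.of_forall fun u => le_min (hGnonneg u) hy.1) hmeas.aestronglyMeasurable]
  exact setIntegral_congr_fun measurableSet_Icc fun u hu => by
    simp only [hGg u (hsub hu)]

/-- For a monotonically decreasing `g : [0,1] → [0,1]`,
`∫_{x}^{1} f1(z, g x) dz = x·g(x)·(1 − x) + ∫_{x}^{1} (1 − y)·g(y) dy`. -/
theorem f1_integral_ell3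
    (g : ℝ → ℝ) (hmono : AntitoneOn g (Icc (0:ℝ) 1))
    (hrange : ∀ x ∈ Icc (0:ℝ) 1, g x ∈ Icc (0:ℝ) 1) :
    ∀ x ∈ Icc (0:ℝ) 1,
      (∫ z in x..1, f1 (hypo g) z (g x))
        = x * g x * (1 - x) + ∫ y in x..1, (1 - y) * g y := by
  intro x hx
  have hint : ∀ a ∈ Icc (0:ℝ) 1, ∀ b ∈ Icc (0:ℝ) 1, IntervalIntegrable g volume a b :=
    fun a ha b hb => (hmono.mono (uIcc_subset_Icc ha hb)).intervalIntegrable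
  have hone : (1:ℝ) ∈ Icc (0:ℝ) 1 := right_mem_Icc.2 zero_le_one
  have hzero : (0:ℝ) ∈ Icc (0:ℝ) 1 := left_mem_Icc.2 zero_le_one
  have hf1 : ∀ z ∈ uIcc x 1, f1 (hypo g) z (g x) = x * g x + ∫ u in x..z, g u := by
    intro z hz
    rw [uIcc_of_le hx.2] at hz
    have hz01 : z ∈ Icc (0:ℝ) 1 := ⟨hx.1.trans hz.1, hz.2⟩
    have hleft : EqOn (fun u => min (g u) (g x)) (fun _ => g x) (uIcc 0 x) := by
      intro u hu
      rw [uIcc_of_le hx.1] at hu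
      exact min_eq_right (hmono ⟨hu.1, hu.2.trans hx.2⟩ hx hu.2)
    have hright : EqOn (fun u => min (g u) (g x)) g (uIcc x z) := by
      intro u hu
      rw [uIcc_of_le hz.1] at hu
      exact min_eq_left (hmono hx ⟨hx.1.trans hu.1, hu.2.trans hz.2⟩ hu.1)
    have hmin : AntitoneOn (fun u => min (g u) (g x)) (Icc (0:ℝ) 1) :=
      fun u hu v hv huv => min_le_min_right _ (hmono hu hv huv)
    rw [f1_hypo_eq_integral_min hmono hrange hz01 (hrange x hx),
      ← intervalIntegral.integral_add_adjacent_intervals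
        (hmin.mono (uIcc_subset_Icc hzero hx)).intervalIntegrable
        (hmin.mono (uIcc_subset_Icc hx hz01)).intervalIntegrable,
      intervalIntegral.integral_congr hleft, intervalIntegral.integral_congr hright]
    simp
  have hcont := ((hint x hx 1 hone).absolutelyContinuousOnInterval_intervalIntegral
    left_mem_uIcc).continuousOn
  rw [intervalIntegral.integral_congr hf1,
    intervalIntegral.integral_add intervalIntegrable_const hcont.intervalIntegrable,
    integral_integral_eq_integral_sub_mul (hint x hx 1 hone), intervalIntegral.integral_const,
    smul_eq_mul, mul_comm (1 - x)]
end
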